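/- (Proposition on transparent repair.) Let φ = ∀π₁…∀πₙ.ψ be a ∀ⁿ HyperLTL formula, and let P, Q be terminating programs with SymPaths_max(P) and SymPaths_max(Q) finite. Then Q is a fully transparent repair of (P, φ) if and only if the formula enc^φ_{SymPaths_max(Q)} ∧ trans^φ_{SymPaths_max(P), SymPaths_max(Q)} is valid. -/

import Mathlib

namespace HyRep

/-- A (concrete) store maps program variables to integers. -/
abbrev Store (X : Type) := X → ℤ

/-- Programs of the simple while-language (with shallowly embedded integer
and Boolean expressions over the variables `X`). -/
inductive Prog (X : Type) : Type where
  | skip : Prog X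
  | assign (x : X) (e : Store X → ℤ) : Prog X
  | ite (b : Store X → Bool) (p q : Prog X) : Prog X
  | whileLoop (b : Store X → Bool) (p : Prog X) : Prog X
  | seq (p q : Prog X) : Prog X
  | observe : Prog X

/-- A configuration is a program together with a store. -/
abbrev Config (X : Type) := Prog X × Store X

/-- The labelled small-step semantics: the label `none` is the silent label ε,
while `some σ` is the observation of the store `σ` (emitted by `observe`). -/
inductive Step {X : Type} [DecidableEq X] :
    Config X → Option (Store X) → Config X → Prop where
  | assign {x : X} {e : Store X → ℤ} {σ : Store X} :
      Step (.assign x e, σ) none (.skip, Function.update σ x (e σ))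
  | observe {σ : Store X} : Step (.observe, σ) (some σ) (.skip, σ)
  | iteTrue {b : Store X → Bool} {p q : Prog X} {σ : Store X} (h : b σ = true) :
      Step (.ite b p q, σ) none (p, σ)
  | iteFalse {b : Store X → Bool} {p q : Prog X} {σ : Store X} (h : b σ = false) :
      Step (.ite b p q, σ) none (q, σ)
  | whileTrue {b : Store X → Bool} {p : Prog X} {σ : Store X} (h : b σ = true) :
      Step (.whileLoop b p, σ) none (.seq p (.whileLoop b p), σ)
  | whileFalse {b : Store X → Bool} {p : Prog X} {σ : Store X} (h : b σ = false) :
      Step (.whileLoop b p, σ) none (.skip, σ)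
  | seqSkip {p : Prog X} {σ : Store X} : Step (.seq .skip p, σ) none (p, σ)
  | seqStep {p p' q : Prog X} {σ σ' : Store X} {μ : Option (Store X)}
      (h : Step (p, σ) μ (p', σ')) : Step (.seq p q, σ) μ (.seq p' q, σ')

/-- An execution from configuration `C`: a (finite or infinite) sequence of
labelled small steps.  `len : ℕ∞` is the number of steps; `cfg i` is the `i`-th
configuration and `lbl i` the label of the step from `cfg i` to `cfg (i+1)`
(the values of `cfg`/`lbl` beyond `len` are irrelevant). -/
structure Exec {X : Type} [DecidableEq X] (C : Config X) where
  len : ℕ∞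
  cfg : ℕ → Config X
  lbl : ℕ → Option (Store X)
  init : cfg 0 = C
  step : ∀ i : ℕ, (i : ℕ∞) + 1 ≤ len → Step (cfg i) (lbl i) (cfg (i + 1))

/-- An execution is maximal if it is infinite or ends in a configuration whose
program component is `skip`. -/
def Exec.Maximal {X : Type} [DecidableEq X] {C : Config X} (ρ : Exec C) : Prop :=
  ρ.len = ⊤ ∨ ∃ n : ℕ, ρ.len = (n : ℕ∞) ∧ (ρ.cfg n).1 = Prog.skip

/-- The indices (within the length of the execution) at which an observation
(a non-ε label) is emitted. -/
def Exec.ObsIdx {X : Type} [DecidableEq X] {C : Config X} (ρ : Exec C) : ℕ → Prop :=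
  fun i => (i : ℕ∞) + 1 ≤ ρ.len ∧ (ρ.lbl i).isSome

/-- A (finite or infinite) trace: a sequence of stores of length `len`
(values of `get` beyond `len` are irrelevant). -/
structure Trace (X : Type) where
  len : ℕ∞
  get : ℕ → Store X

open Classical in
/-- The observation sequence of an execution: the sequence of observed stores,
obtained by removing all ε labels. -/
noncomputable def Exec.obs {X : Type} [DecidableEq X] {C : Config X}
    (ρ : Exec C) : Trace X where
  len := if h : {i | ρ.ObsIdx i}.Finite then (h.toFinset.card : ℕ∞) else ⊤
  get := fun k => (ρ.lbl (Nat.nth ρ.ObsIdx k)).getD (fun _ => 0)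

open Classical in
/-- The observation sequence `obs(P, σ)` along the (unique) maximal execution
from `⟨P, σ⟩`. -/
noncomputable def obsTrace {X : Type} [DecidableEq X] (P : Prog X) (σ : Store X) :
    Trace X :=
  if h : ∃ ρ : Exec (P, σ), ρ.Maximal then h.choose.obs else ⟨0, fun _ _ => 0⟩

/-- `Traces(P)`: the set of observation sequences of maximal executions of `P`. -/
def Traces {X : Type} [DecidableEq X] (P : Prog X) : Set (Trace X) :=
  { t | ∃ (σ : Store X) (ρ : Exec (P, σ)), ρ.Maximal ∧ t = ρ.obs }

/-- A program is terminating if all of its (maximal) executions are finite. -/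
def Terminating {X : Type} [DecidableEq X] (P : Prog X) : Prop :=
  ∀ (σ : Store X) (ρ : Exec (P, σ)), ρ.Maximal → ∃ n : ℕ, ρ.len = (n : ℕ∞)

/-! ### Symbolic execution -/

/-- A symbolic store maps each variable to an (integer) expression over `X`. -/
abbrev SymStore (X : Type) := X → Store X → ℤ

/-- A path condition: a first-order condition on stores. -/
abbrev PathCond (X : Type) := Store X → Prop

/-- Symbolic configurations `⟨P, ν, α, β⟩`. -/
abbrev SymConfig (X : Type) := Prog X × SymStore X × PathCond X × List (SymStore X)

/-- Substitute the symbolic store `ν` into the integer expression `e`. -/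
def symEvalA {X : Type} (e : Store X → ℤ) (ν : SymStore X) : Store X → ℤ :=
  fun σ => e fun x => ν x σ

/-- Substitute the symbolic store `ν` into the Boolean expression `b`. -/
def symEvalB {X : Type} (b : Store X → Bool) (ν : SymStore X) : Store X → Bool :=
  fun σ => b fun x => ν x σ

/-- Small-step symbolic execution. -/
inductive SymStep {X : Type} [DecidableEq X] : SymConfig X → SymConfig X → Prop where
  | assign {x : X} {e : Store X → ℤ} {ν : SymStore X} {α : PathCond X}
      {β : List (SymStore X)} :
      SymStep (.assign x e, ν, α, β) (.skip, Function.update ν x (symEvalA e ν), α, β)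
  | observe {ν : SymStore X} {α : PathCond X} {β : List (SymStore X)} :
      SymStep (.observe, ν, α, β) (.skip, ν, α, β ++ [ν])
  | iteTrue {b : Store X → Bool} {p q : Prog X} {ν : SymStore X} {α : PathCond X}
      {β : List (SymStore X)} :
      SymStep (.ite b p q, ν, α, β) (p, ν, fun σ => α σ ∧ symEvalB b ν σ = true, β)
  | iteFalse {b : Store X → Bool} {p q : Prog X} {ν : SymStore X} {α : PathCond X}
      {β : List (SymStore X)} :
      SymStep (.ite b p q, ν, α, β) (q, ν, fun σ => α σ ∧ symEvalB b ν σ = false, β)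
  | whileTrue {b : Store X → Bool} {p : Prog X} {ν : SymStore X} {α : PathCond X}
      {β : List (SymStore X)} :
      SymStep (.whileLoop b p, ν, α, β)
        (.seq p (.whileLoop b p), ν, fun σ => α σ ∧ symEvalB b ν σ = true, β)
  | whileFalse {b : Store X → Bool} {p : Prog X} {ν : SymStore X} {α : PathCond X}
      {β : List (SymStore X)} :
      SymStep (.whileLoop b p, ν, α, β) (.skip, ν, fun σ => α σ ∧ symEvalB b ν σ = false, β)
  | seqSkip {p : Prog X} {ν : SymStore X} {α : PathCond X} {β : List (SymStore X)} :
      SymStep (.seq .skip p, ν, α, β) (p, ν, α, β)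
  | seqStep {p p' q : Prog X} {ν ν' : SymStore X} {α α' : PathCond X}
      {β β' : List (SymStore X)} (h : SymStep (p, ν, α, β) (p', ν', α', β')) :
      SymStep (.seq p q, ν, α, β) (.seq p' q, ν', α', β')

/-- The initial symbolic store `ν₀`, mapping each variable to itself. -/
def initSym {X : Type} : SymStore X := fun x σ => σ x

/-- A symbolic path: a path condition together with a symbolic observation sequence. -/
abbrev SymPath (X : Type) := PathCond X × List (SymStore X)

/-- `(α, β)` is a symbolic path of `P`: it is reached by some finite symbolic
execution starting from `⟨P, ν₀, true, ε⟩`. -/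
def IsSymPath {X : Type} [DecidableEq X] (P : Prog X) (p : SymPath X) : Prop :=
  ∃ (P' : Prog X) (ν : SymStore X),
    Relation.ReflTransGen SymStep (P, initSym, fun _ => True, []) (P', ν, p.1, p.2)

/-- `(α, β)` is a maximal symbolic path of `P`: the reached program is `skip`. -/
def IsMaxSymPath {X : Type} [DecidableEq X] (P : Prog X) (p : SymPath X) : Prop :=
  ∃ ν : SymStore X,
    Relation.ReflTransGen SymStep (P, initSym, fun _ => True, []) (.skip, ν, p.1, p.2)

/-- `SymPaths(P)`: all satisfiable symbolic paths of `P`. -/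
def SymPaths {X : Type} [DecidableEq X] (P : Prog X) : Set (SymPath X) :=
  { p | IsSymPath P p ∧ ∃ σ : Store X, p.1 σ }

/-- `SymPaths_max(P)`: all satisfiable maximal symbolic paths of `P`. -/
def SymPathsMax {X : Type} [DecidableEq X] (P : Prog X) : Set (SymPath X) :=
  { p | IsMaxSymPath P p ∧ ∃ σ : Store X, p.1 σ }

/-- Evaluate a symbolic observation sequence at a concrete store,
yielding a concrete observation sequence (a list of stores). -/
def evalObs {X : Type} (β : List (SymStore X)) (σ : Store X) : List (Store X) :=
  β.map fun ν x => ν x σ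

/-- Evaluate a symbolic observation sequence at a concrete store, as a trace. -/
def evalTrace {X : Type} (β : List (SymStore X)) (σ : Store X) : Trace X :=
  ⟨(β.length : ℕ∞), fun i x => (β.getD i initSym) x σ⟩

/-! ### HyperLTL -/

/-- Bodies of HyperLTL formulas over `n` trace variables: atoms are (shallowly
embedded) first-order predicates over the indexed variables `x_{π_j}` (i.e.,
predicates over one store per trace variable); negation occurs only inside
atoms, and the temporal operators are next `X` and weak-until `W`. -/
inductive LTLBody (X : Type) : ℕ → Type 1 where
  | atom {n : ℕ} (θ : (Fin n → Store X) → Prop) : LTLBody X n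
  | and {n : ℕ} (ψ₁ ψ₂ : LTLBody X n) : LTLBody X n
  | or {n : ℕ} (ψ₁ ψ₂ : LTLBody X n) : LTLBody X n
  | next {n : ℕ} (ψ : LTLBody X n) : LTLBody X n
  | wuntil {n : ℕ} (ψ₁ ψ₂ : LTLBody X n) : LTLBody X n

/-- Vacuous satisfaction: some bound trace is shorter than the current position. -/
def vac {X : Type} {n : ℕ} (Tr : Fin n → Trace X) (i : ℕ) : Prop :=
  ∃ j : Fin n, (Tr j).len ≤ (i : ℕ∞)

/-- Satisfaction `Π, i ⊨ ψ` of an LTL body on a trace assignment `Tr`. -/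
def BodySat {X : Type} {n : ℕ} (Tr : Fin n → Trace X) : LTLBody X n → ℕ → Prop
  | .atom θ => fun i => vac Tr i ∨ θ fun j => (Tr j).get i
  | .and ψ₁ ψ₂ => fun i => vac Tr i ∨ (BodySat Tr ψ₁ i ∧ BodySat Tr ψ₂ i)
  | .or ψ₁ ψ₂ => fun i => vac Tr i ∨ (BodySat Tr ψ₁ i ∨ BodySat Tr ψ₂ i)
  | .next ψ => fun i => vac Tr i ∨ BodySat Tr ψ (i + 1)
  | .wuntil ψ₁ ψ₂ => fun i => vac Tr i ∨
      ((∃ j : ℕ, i ≤ j ∧ BodySat Tr ψ₂ j ∧ ∀ k : ℕ, i ≤ k → k < j → BodySat Tr ψ₁ k) ∨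
        ∀ j : ℕ, i ≤ j → BodySat Tr ψ₁ j)

/-- HyperLTL formulas: a quantifier prefix over trace variables followed by an
LTL body; `HyperLTL X n` has `n` already-bound (outer) trace variables. -/
inductive HyperLTL (X : Type) : ℕ → Type 1 where
  | body {n : ℕ} (ψ : LTLBody X n) : HyperLTL X n
  | uall {n : ℕ} (φ : HyperLTL X (n + 1)) : HyperLTL X n
  | uex {n : ℕ} (φ : HyperLTL X (n + 1)) : HyperLTL X n

/-- HyperLTL satisfaction `Π, 0 ⊨_T φ`, with quantifiers ranging over `T`. -/
def HSat {X : Type} (T : Set (Trace X)) :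
    {n : ℕ} → HyperLTL X n → (Fin n → Trace X) → Prop
  | _, .body ψ, Tr => BodySat Tr ψ 0
  | _, .uall φ, Tr => ∀ t ∈ T, HSat T φ (Fin.snoc Tr t)
  | _, .uex φ, Tr => ∃ t ∈ T, HSat T φ (Fin.snoc Tr t)

/-- `P ⊨ φ`, i.e., `∅, 0 ⊨_{Traces(P)} φ`. -/
def Sat {X : Type} [DecidableEq X] (P : Prog X) (φ : HyperLTL X 0) : Prop :=
  HSat (Traces P) φ Fin.elim0

/-- The formula is a `∀*` formula (all quantifiers universal). -/
def IsUniv {X : Type} : {n : ℕ} → HyperLTL X n → Prop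
  | _, .body _ => True
  | _, .uall φ => IsUniv φ
  | _, .uex _ => False

/-- The formula is an `∃*` formula (all quantifiers existential). -/
def IsExist {X : Type} : {n : ℕ} → HyperLTL X n → Prop
  | _, .body _ => True
  | _, .uall _ => False
  | _, .uex φ => IsExist φ

/-- Satisfaction of the `∀ⁿ` HyperLTL formula `∀π₁…∀πₙ. ψ` by program `P`. -/
def SatAll {X : Type} [DecidableEq X] (P : Prog X) {n : ℕ} (ψ : LTLBody X n) : Prop :=
  ∀ Tr : Fin n → Trace X, (∀ j, Tr j ∈ Traces P) → BodySat Tr ψ 0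

/-! ### The encodings -/

/-- The encoding `enc^φ_Ps`: each trace quantifier is resolved on the symbolic
paths in `Ps` (introducing a fresh copy of the program variables, i.e., a store,
and asserting the path condition on it); the body case asserts `acc^ψ_Δ`,
i.e., that the instantiated symbolic observation sequences satisfy `ψ`. -/
def enc {X : Type} (Ps : Set (SymPath X)) :
    {n : ℕ} → HyperLTL X n → (Fin n → Store X) → (Fin n → List (SymStore X)) → Prop
  | _, .body ψ, v, Δ => BodySat (fun j => evalTrace (Δ j) (v j)) ψ 0
  | _, .uall φ, v, Δ => ∀ σ : Store X, ∀ p ∈ Ps, p.1 σ →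
      enc Ps φ (Fin.snoc v σ) (Fin.snoc Δ p.2)
  | _, .uex φ, v, Δ => ∃ σ : Store X, ∃ p ∈ Ps, p.1 σ ∧
      enc Ps φ (Fin.snoc v σ) (Fin.snoc Δ p.2)

/-- The encoding `enc^φ_Ps` for the `∀ⁿ` formula `∀π₁…∀πₙ. ψ`. -/
def encAll {X : Type} {n : ℕ} (ψ : LTLBody X n) (Ps : Set (SymPath X)) : Prop :=
  ∀ (σs : Fin n → Store X) (ps : Fin n → SymPath X),
    (∀ j, ps j ∈ Ps) → (∀ j, (ps j).1 (σs j)) →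
    BodySat (fun j => evalTrace (ps j).2 (σs j)) ψ 0

/-- `t ≠_{X_out} t'`: at some position within both sequences the stores
differ on some output variable. -/
def OutDiff {X : Type} (Xout : Set X) (t t' : Trace X) : Prop :=
  ∃ i : ℕ, (i : ℕ∞) < t.len ∧ (i : ℕ∞) < t'.len ∧ ∃ x ∈ Xout, t.get i x ≠ t'.get i x

/-- `Q` is a fully transparent repair of `(P, ∀π₁…∀πₙ. ψ)`. -/
def FullyTransparent {X : Type} [DecidableEq X] (Xout : Set X) {n : ℕ}
    (ψ : LTLBody X n) (P Q : Prog X) : Prop :=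
  SatAll Q ψ ∧
  ∀ σ : Store X, OutDiff Xout (obsTrace P σ) (obsTrace Q σ) →
    ∃ σs : Fin n → Store X, (∃ j, σ = σs j) ∧
      ¬ BodySat (fun j => obsTrace P (σs j)) ψ 0

/-- `Q` is a better repair than `S` w.r.t. `(P, φ)`. -/
def BetterRepair {X : Type} [DecidableEq X] (Xout : Set X) (φ : HyperLTL X 0)
    (P Q S : Prog X) : Prop :=
  Sat Q φ ∧
  (∀ σ : Store X, OutDiff Xout (obsTrace P σ) (obsTrace Q σ) →
      OutDiff Xout (obsTrace P σ) (obsTrace S σ)) ∧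
  (∃ σ : Store X, OutDiff Xout (obsTrace P σ) (obsTrace S σ) ∧
      ¬ OutDiff Xout (obsTrace P σ) (obsTrace Q σ))

/-- The encoding `trans^φ_{Ps_P, Ps_Q}` for fully transparent repair
(for `φ = ∀π₁…∀πₙ. ψ`). -/
def transEnc {X : Type} (Xout : Set X) {n : ℕ} (ψ : LTLBody X n)
    (PP PQ : Set (SymPath X)) : Prop :=
  ∀ σ : Store X,
    (∃ pP ∈ PP, ∃ pQ ∈ PQ, pP.1 σ ∧ pQ.1 σ ∧
      ∃ i < min pP.2.length pQ.2.length, ∃ x ∈ Xout,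
        (pP.2.getD i initSym) x σ ≠ (pQ.2.getD i initSym) x σ) →
    ∃ (σs : Fin n → Store X) (ps : Fin n → SymPath X),
      (∀ j, ps j ∈ PP) ∧ (∀ j, (ps j).1 (σs j)) ∧ (∃ j, σ = σs j) ∧
      ¬ BodySat (fun j => evalTrace (ps j).2 (σs j)) ψ 0

/-- The encoding `iter_{Ps_P, Ps_S, Ps_Q}` for iterative repair. -/
def iterEnc {X : Type} (Xout : Set X) (PP PS PQ : Set (SymPath X)) : Prop :=
  (∀ σ : Store X, ∀ pP ∈ PP, ∀ pS ∈ PS, ∀ pQ ∈ PQ,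
    pP.1 σ → pS.1 σ → pQ.1 σ →
    (∃ i < min pP.2.length pQ.2.length, ∃ x ∈ Xout,
        (pP.2.getD i initSym) x σ ≠ (pQ.2.getD i initSym) x σ) →
    (∃ i < min pP.2.length pS.2.length, ∃ x ∈ Xout,
        (pP.2.getD i initSym) x σ ≠ (pS.2.getD i initSym) x σ)) ∧
  (∃ σ : Store X, ∃ pP ∈ PP, ∃ pS ∈ PS, ∃ pQ ∈ PQ,
    pP.1 σ ∧ pS.1 σ ∧ pQ.1 σ ∧
    (∃ i < min pP.2.length pS.2.length, ∃ x ∈ Xout,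
        (pP.2.getD i initSym) x σ ≠ (pS.2.getD i initSym) x σ) ∧
    (∀ i < min pP.2.length pQ.2.length, ∀ x ∈ Xout,
        (pP.2.getD i initSym) x σ = (pQ.2.getD i initSym) x σ))

/-- A program is loop-free if it contains no `while` statement. -/
def LoopFree {X : Type} : Prog X → Prop
  | .skip => True
  | .assign _ _ => True
  | .observe => True
  | .ite _ p q => LoopFree p ∧ LoopFree q
  | .whileLoop _ _ => False
  | .seq p q => LoopFree p ∧ LoopFree q

/-- `Run C l D`: finitely many small steps lead from `C` to `D`, emitting the stores `l`. -/
inductive Run {X : Type} [DecidableEq X] : Config X → List (Store X) → Config X → Prop where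
  | refl (C : Config X) : Run C [] C
  | head {C C' D : Config X} {μ : Option (Store X)} {l : List (Store X)}
      (h : Step C μ C') (hr : Run C' l D) : Run C (μ.toList ++ l) D

/-- The trace `t` is the finite sequence `l`. -/
def Trace.Represents {X : Type} (t : Trace X) (l : List (Store X)) : Prop :=
  t.len = l.length ∧ ∀ (i : ℕ) (h : i < l.length), t.get i = l[i]

/-- Two traces agree as sequences of stores. -/
def Trace.Agree {X : Type} (t t' : Trace X) : Prop :=
  t.len = t'.len ∧ ∀ i : ℕ, (i : ℕ∞) < t.len → t.get i = t'.get i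

lemma Trace.Represents.agree {X : Type} {t t' : Trace X} {l : List (Store X)}
    (h : t.Represents l) (h' : t'.Represents l) : t.Agree t' := by
  refine ⟨h.1.trans h'.1.symm, fun i hi => ?_⟩
  rw [h.1] at hi
  have hi' : i < l.length := by exact_mod_cast hi
  rw [h.2 i hi', h'.2 i hi']

lemma evalTrace_represents {X : Type} (β : List (SymStore X)) (σ : Store X) :
    (evalTrace β σ).Represents (evalObs β σ) := by
  refine ⟨by simp [evalTrace, evalObs], fun i hi => ?_⟩
  have hi' : i < β.length := by simpa [evalObs] using hi
  simp [evalTrace, evalObs, hi']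

section Semantics

variable {X : Type} [DecidableEq X]

lemma not_step_skip {σ : Store X} {μ : Option (Store X)} {C : Config X} :
    ¬ Step (.skip, σ) μ C := nofun

lemma Step.deterministic {P : Prog X} : ∀ {σ : Store X} {μ μ' : Option (Store X)}
    {C C' : Config X}, Step (P, σ) μ C → Step (P, σ) μ' C' → μ = μ' ∧ C = C' := by
  induction P with
  | skip => exact fun h => absurd h not_step_skip
  | assign x e => intro σ μ μ' C C' h h'; cases h; cases h'; exact ⟨rfl, rfl⟩
  | observe => intro σ μ μ' C C' h h'; cases h; cases h'; exact ⟨rfl, rfl⟩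
  | ite b p q => intro σ μ μ' C C' h h'; cases h <;> cases h' <;> simp_all
  | whileLoop b p => intro σ μ μ' C C' h h'; cases h <;> cases h' <;> simp_all
  | seq p q ihp =>
    intro σ μ μ' C C' h h'
    cases h with
    | seqSkip =>
      cases h' with
      | seqSkip => exact ⟨rfl, rfl⟩
      | seqStep h' => exact absurd h' not_step_skip
    | seqStep h =>
      cases h' with
      | seqSkip => exact absurd h not_step_skip
      | seqStep h' =>
        obtain ⟨rfl, hC⟩ := ihp h h'
        cases hC
        exact ⟨rfl, rfl⟩

lemma exists_step {P : Prog X} (hP : P ≠ .skip) (σ : Store X) :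
    ∃ μ C, Step (P, σ) μ C := by
  induction P with
  | skip => exact absurd rfl hP
  | assign x e => exact ⟨_, _, .assign⟩
  | observe => exact ⟨_, _, .observe⟩
  | ite b p q =>
    cases h : b σ with
    | true => exact ⟨_, _, .iteTrue h⟩
    | false => exact ⟨_, _, .iteFalse h⟩
  | whileLoop b p =>
    cases h : b σ with
    | true => exact ⟨_, _, .whileTrue h⟩
    | false => exact ⟨_, _, .whileFalse h⟩
  | seq p q ihp =>
    by_cases hp : p = .skip
    · subst hp
      exact ⟨_, _, .seqSkip⟩
    · obtain ⟨μ, ⟨p', σ'⟩, h⟩ := ihp hp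
      exact ⟨_, _, .seqStep h⟩

lemma exists_maximal_exec (C : Config X) : ∃ ρ : Exec C, ρ.Maximal := by
  have hstep : ∀ D : Config X, ∃ r : Option (Store X) × Config X,
      D.1 ≠ .skip → Step D r.1 r.2 := by
    rintro ⟨P, σ⟩
    by_cases hP : P = .skip
    · exact ⟨(none, (P, σ)), fun h => absurd hP h⟩
    · obtain ⟨μ, D, h⟩ := exists_step hP σ
      exact ⟨(μ, D), fun _ => h⟩
  choose next hnext using hstep
  let cfg : ℕ → Config X := fun i => (fun D => (next D).2)^[i] C
  have hcfg : ∀ i, (cfg i).1 ≠ .skip → Step (cfg i) (next (cfg i)).1 (cfg (i + 1)) := by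
    intro i hi
    simp only [cfg, Function.iterate_succ_apply']
    exact hnext _ hi
  classical
  by_cases hfin : ∃ m, (cfg m).1 = .skip
  · refine ⟨⟨Nat.find hfin, cfg, fun i => (next (cfg i)).1, rfl, fun i hi => hcfg i ?_⟩,
      .inr ⟨_, rfl, Nat.find_spec hfin⟩⟩
    exact Nat.find_min hfin (by exact_mod_cast hi)
  · push Not at hfin
    exact ⟨⟨⊤, cfg, fun i => (next (cfg i)).1, rfl, fun i _ => hcfg i (hfin i)⟩, .inl rfl⟩

lemma Exec.Maximal.cfg_fst_eq_skip {C : Config X} {ρ : Exec C} (hρ : ρ.Maximal) {m : ℕ}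
    (hm : ρ.len = m) : (ρ.cfg m).1 = .skip := by
  rcases hρ with h | ⟨k, hk, h⟩
  · simp [h] at hm
  · obtain rfl : k = m := by exact_mod_cast hk.symm.trans hm
    exact h

lemma exists_obsTrace_eq (P : Prog X) (σ : Store X) :
    ∃ ρ : Exec (P, σ), ρ.Maximal ∧ obsTrace P σ = ρ.obs := by
  have h := exists_maximal_exec (P, σ)
  exact ⟨h.choose, h.choose_spec, by rw [obsTrace, dif_pos h]⟩

lemma Run.tail {C D E : Config X} {l : List (Store X)} {μ : Option (Store X)}
    (hr : Run C l D) (h : Step D μ E) : Run C (l ++ μ.toList) E := by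
  induction hr with
  | refl C => simpa using Run.head h (.refl E)
  | head h' _ ih => simpa using Run.head h' (ih h)

lemma Run.deterministic {C D D' : Config X} {l l' : List (Store X)}
    (h : Run C l D) (hD : D.1 = .skip) (h' : Run C l' D') (hD' : D'.1 = .skip) : l = l' := by
  induction h generalizing l' with
  | refl C =>
    obtain ⟨P, σ⟩ := C
    obtain rfl : P = .skip := hD
    cases h' with
    | refl => rfl
    | head h _ => exact absurd h not_step_skip
  | @head C _ _ _ _ h _ ih =>
    obtain ⟨P, σ⟩ := C
    cases h' with
    | refl =>
      obtain rfl : P = .skip := hD'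
      exact absurd h not_step_skip
    | head h' hr' =>
      obtain ⟨rfl, rfl⟩ := h.deterministic h'
      rw [ih hD hr']

lemma Exec.run {C : Config X} (ρ : Exec C) (m : ℕ) (hm : (m : ℕ∞) ≤ ρ.len) :
    Run C ((List.range m).filterMap ρ.lbl) (ρ.cfg m) := by
  induction m with
  | zero => simpa [ρ.init] using Run.refl C
  | succ m ih =>
    push_cast at hm
    have h := (ih (le_self_add.trans hm)).tail (ρ.step m hm)
    rw [List.range_succ, List.filterMap_append]
    convert h using 2
    cases h : ρ.lbl m <;> simp [h]

open Classical in
lemma Exec.filterMap_range_lbl {C : Config X} (ρ : Exec C) (m : ℕ) (hm : (m : ℕ∞) ≤ ρ.len) :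
    ((List.range m).filterMap ρ.lbl).length = Nat.count ρ.ObsIdx m ∧
      ∀ k < Nat.count ρ.ObsIdx m,
        ((List.range m).filterMap ρ.lbl)[k]? = ρ.lbl (Nat.nth ρ.ObsIdx k) := by
  induction m with
  | zero => simp
  | succ m ih =>
    push_cast at hm
    obtain ⟨hlen, hget⟩ := ih (le_self_add.trans hm)
    rw [List.range_succ, List.filterMap_append, Nat.count_succ]
    cases hl : ρ.lbl m with
    | none =>
      have hm' : ¬ ρ.ObsIdx m := by simp [Exec.ObsIdx, hl]
      simpa [hl, hm', hlen] using hget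
    | some τ =>
      have hm' : ρ.ObsIdx m := ⟨hm, by simp [hl]⟩
      refine ⟨by simp [hl, hm', hlen], fun k hk => ?_⟩
      rw [if_pos hm', Nat.lt_succ_iff_lt_or_eq] at hk
      rcases hk with hk | rfl
      · rw [List.getElem?_append_left (hlen ▸ hk), hget k hk]
      · rw [Nat.nth_count hm', List.getElem?_append_right hlen.le]
        simp [hl, hlen]

lemma Exec.obs_represents {C : Config X} (ρ : Exec C) {m : ℕ} (hm : ρ.len = m) :
    ρ.obs.Represents ((List.range m).filterMap ρ.lbl) := by
  classical
  obtain ⟨hlen, hget⟩ := ρ.filterMap_range_lbl m hm.ge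
  have hset : {i | ρ.ObsIdx i} = ↑((Finset.range m).filter ρ.ObsIdx) := by
    ext i
    simp only [Set.mem_ofPred_eq, Finset.coe_filter, Finset.mem_range]
    refine ⟨fun h => ⟨?_, h⟩, And.right⟩
    have h1 := h.1
    rw [hm] at h1
    exact_mod_cast h1
  have hfin : {i | ρ.ObsIdx i}.Finite := hset ▸ Finset.finite_toSet _
  refine ⟨?_, fun i hi => ?_⟩
  · have hcard : hfin.toFinset = (Finset.range m).filter ρ.ObsIdx := by
      ext i
      rw [Set.Finite.mem_toFinset, hset, Finset.mem_coe]
    simp only [Exec.obs, dif_pos hfin]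
    rw [hlen, Nat.count_eq_card_filter_range, hcard]
  · have h := hget i (hlen ▸ hi)
    rw [List.getElem?_eq_getElem hi] at h
    simp only [Exec.obs, ← h, Option.getD_some]

lemma eval_update (ν : SymStore X) (x : X) (e : Store X → ℤ) (σ : Store X) :
    (fun y => Function.update ν x (symEvalA e ν) y σ) =
      Function.update (fun y => ν y σ) x (e fun y => ν y σ) := by
  funext y
  by_cases hy : y = x
  · subst hy; simp [symEvalA]
  · simp [hy]

lemma SymStep.run_of_reflTransGen {S T : SymConfig X}
    (h : Relation.ReflTransGen SymStep S T) {σ : Store X} (hσ : T.2.2.1 σ) :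
    S.2.2.1 σ ∧ ∃ l, Run (S.1, fun x => S.2.1 x σ) l (T.1, fun x => T.2.1 x σ) ∧
      evalObs T.2.2.2 σ = evalObs S.2.2.2 σ ++ l := by
  have hstep : ∀ {S S' : SymConfig X}, SymStep S S' → S'.2.2.1 σ → S.2.2.1 σ ∧
      ∃ μ, Step (S.1, fun x => S.2.1 x σ) μ (S'.1, fun x => S'.2.1 x σ) ∧
        evalObs S'.2.2.2 σ = evalObs S.2.2.2 σ ++ μ.toList := by
    intro S S' hS hσ'
    induction hS with
    | @assign x e ν α β =>
      refine ⟨hσ', none, ?_, by simp⟩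
      simp only [eval_update]
      exact .assign
    | observe => exact ⟨hσ', _, .observe, by simp [evalObs]⟩
    | iteTrue => exact ⟨hσ'.1, none, .iteTrue hσ'.2, by simp⟩
    | iteFalse => exact ⟨hσ'.1, none, .iteFalse hσ'.2, by simp⟩
    | whileTrue => exact ⟨hσ'.1, none, .whileTrue hσ'.2, by simp⟩
    | whileFalse => exact ⟨hσ'.1, none, .whileFalse hσ'.2, by simp⟩
    | seqSkip => exact ⟨hσ', none, .seqSkip, by simp⟩
    | seqStep _ ih =>
      obtain ⟨hα, μ, hs, hβ⟩ := ih hσ'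
      exact ⟨hα, μ, .seqStep hs, hβ⟩
  induction h using Relation.ReflTransGen.head_induction_on with
  | refl => exact ⟨hσ, [], .refl _, by simp⟩
  | head hs _ ih =>
    obtain ⟨hα, l, hr, hβ⟩ := ih
    obtain ⟨hα', μ, hs', hβ'⟩ := hstep hs hα
    exact ⟨hα', _, .head hs' hr, by rw [hβ, hβ', List.append_assoc]⟩

lemma Step.exists_symStep {P P' : Prog X} {τ τ' σ : Store X} {μ : Option (Store X)}
    (h : Step (P, τ) μ (P', τ')) (ν : SymStore X) (hν : (fun x => ν x σ) = τ)
    (α : PathCond X) (hα : α σ) (β : List (SymStore X)) :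
    ∃ ν' α' β', SymStep (P, ν, α, β) (P', ν', α', β') ∧
      (fun x => ν' x σ) = τ' ∧ α' σ := by
  subst hν
  induction P generalizing P' with
  | skip => exact absurd h not_step_skip
  | assign x e =>
    cases h
    exact ⟨_, _, _, .assign, eval_update ν x e σ, hα⟩
  | observe => cases h; exact ⟨_, _, _, .observe, rfl, hα⟩
  | ite b p q =>
    cases h with
    | iteTrue h => exact ⟨_, _, _, .iteTrue, rfl, hα, h⟩
    | iteFalse h => exact ⟨_, _, _, .iteFalse, rfl, hα, h⟩
  | whileLoop b p =>
    cases h with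
    | whileTrue h => exact ⟨_, _, _, .whileTrue, rfl, hα, h⟩
    | whileFalse h => exact ⟨_, _, _, .whileFalse, rfl, hα, h⟩
  | seq p q ihp =>
    cases h with
    | seqSkip => exact ⟨_, _, _, .seqSkip, rfl, hα⟩
    | seqStep h =>
      obtain ⟨ν', α', β', hs, hν', hα'⟩ := ihp h
      exact ⟨ν', α', β', .seqStep hs, hν', hα'⟩

lemma Run.exists_symPath {C D : Config X} {l : List (Store X)} (h : Run C l D)
    {σ : Store X} (ν : SymStore X) (hν : (fun x => ν x σ) = C.2)
    (α : PathCond X) (hα : α σ) (β : List (SymStore X)) :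
    ∃ ν' α' β', Relation.ReflTransGen SymStep (C.1, ν, α, β) (D.1, ν', α', β') ∧ α' σ := by
  induction h generalizing ν α β with
  | refl C => exact ⟨ν, α, β, .refl, hα⟩
  | head h _ ih =>
    obtain ⟨ν', α', β', hs, hν', hα'⟩ := h.exists_symStep ν hν α hα β
    obtain ⟨ν'', α'', β'', hr, hα''⟩ := ih ν' hν' α' hα' β'
    exact ⟨ν'', α'', β'', .head hs hr, hα''⟩

lemma exists_mem_symPathsMax {P : Prog X} (ht : Terminating P) (σ : Store X) :
    ∃ p ∈ SymPathsMax P, p.1 σ := by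
  obtain ⟨ρ, hρ⟩ := exists_maximal_exec (P, σ)
  obtain ⟨m, hm⟩ := ht σ ρ hρ
  have hskip := hρ.cfg_fst_eq_skip hm
  obtain ⟨ν, α, β, hr, hα⟩ :=
    (ρ.run m hm.ge).exists_symPath initSym rfl (fun _ => True) trivial []
  exact ⟨(α, β), ⟨⟨ν, hskip ▸ hr⟩, σ, hα⟩, hα⟩

lemma Exec.obs_agree_evalTrace {P : Prog X} (ht : Terminating P) {σ : Store X}
    {ρ : Exec (P, σ)} (hρ : ρ.Maximal) {p : SymPath X} (hp : p ∈ SymPathsMax P)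
    (hσ : p.1 σ) : ρ.obs.Agree (evalTrace p.2 σ) := by
  obtain ⟨m, hm⟩ := ht σ ρ hρ
  have hskip := hρ.cfg_fst_eq_skip hm
  obtain ⟨⟨ν, hr⟩, -⟩ := hp
  obtain ⟨-, l, hl, hβ⟩ := SymStep.run_of_reflTransGen hr hσ
  have hβ' : evalObs p.2 σ = l := by simpa [evalObs] using hβ
  have heq := (ρ.run m hm.ge).deterministic hskip hl rfl
  refine (ρ.obs_represents hm).agree ?_
  rw [heq, ← hβ']
  exact evalTrace_represents _ _

lemma obsTrace_agree_evalTrace {P : Prog X} (ht : Terminating P) {σ : Store X}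
    {p : SymPath X} (hp : p ∈ SymPathsMax P) (hσ : p.1 σ) :
    (obsTrace P σ).Agree (evalTrace p.2 σ) := by
  obtain ⟨ρ, hρ, h⟩ := exists_obsTrace_eq P σ
  exact h ▸ Exec.obs_agree_evalTrace ht hρ hp hσ

end Semantics

lemma bodySat_congr {X : Type} {n : ℕ} {Tr Tr' : Fin n → Trace X}
    (h : ∀ j, (Tr j).Agree (Tr' j)) (ψ : LTLBody X n) (i : ℕ) :
    BodySat Tr ψ i ↔ BodySat Tr' ψ i := by
  have hvac : ∀ i, vac Tr i ↔ vac Tr' i := fun i => by simp only [vac, fun j => (h j).1]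
  induction ψ generalizing i with
  | atom θ =>
    simp only [BodySat, ← hvac]
    refine or_congr_right' fun hi => ?_
    have hget : (fun j => (Tr j).get i) = fun j => (Tr' j).get i :=
      funext fun j => (h j).2 i (not_le.mp fun hj => hi ⟨j, hj⟩)
    rw [hget]
  | and _ _ ih₁ ih₂ => simp only [BodySat, hvac, ih₁, ih₂]
  | or _ _ ih₁ ih₂ => simp only [BodySat, hvac, ih₁, ih₂]
  | next _ ih => simp only [BodySat, hvac, ih]
  | wuntil _ _ ih₁ ih₂ => simp only [BodySat, hvac, ih₁, ih₂]

lemma outDiff_congr {X : Type} {Xout : Set X} {s s' t t' : Trace X}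
    (hs : s.Agree s') (ht : t.Agree t') : OutDiff Xout s t ↔ OutDiff Xout s' t' := by
  simp only [OutDiff, ← hs.1, ← ht.1]
  refine exists_congr fun i => and_congr_right fun hi => and_congr_right fun hi' => ?_
  rw [hs.2 i hi, ht.2 i hi']

lemma outDiff_evalTrace_iff {X : Type} {Xout : Set X} {β β' : List (SymStore X)}
    {σ : Store X} : OutDiff Xout (evalTrace β σ) (evalTrace β' σ) ↔
      ∃ i < min β.length β'.length, ∃ x ∈ Xout,
        (β.getD i initSym) x σ ≠ (β'.getD i initSym) x σ := by
  simp only [OutDiff, evalTrace, Nat.cast_lt, lt_min_iff, and_assoc]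

lemma satAll_iff_encAll {X : Type} [DecidableEq X] {n : ℕ} (ψ : LTLBody X n) {Q : Prog X}
    (ht : Terminating Q) : SatAll Q ψ ↔ encAll ψ (SymPathsMax Q) := by
  constructor
  · intro h σs ps hps hσs
    refine (bodySat_congr (fun j => obsTrace_agree_evalTrace ht (hps j) (hσs j)) ψ 0).mp
      (h _ fun j => ?_)
    obtain ⟨ρ, hρ, heq⟩ := exists_obsTrace_eq Q (σs j)
    exact ⟨σs j, ρ, hρ, heq⟩
  · intro h Tr hTr
    choose σs ρs hρs hTr using hTr
    choose ps hps hσs using fun j => exists_mem_symPathsMax ht (σs j)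
    refine (bodySat_congr (fun j => ?_) ψ 0).mpr (h σs ps hps hσs)
    exact hTr j ▸ Exec.obs_agree_evalTrace ht (hρs j) (hps j) (hσs j)

/-- Proposition on transparent repair. For a `∀ⁿ` HyperLTL
formula `φ = ∀π₁…∀πₙ. ψ` and terminating programs `P, Q` with finite sets of
satisfiable maximal symbolic paths, `Q` is a fully transparent repair of
`(P, φ)` iff `enc^φ_{SymPaths_max(Q)} ∧ trans^φ_{SymPaths_max(P), SymPaths_max(Q)}`
is valid. -/
theorem transparent_repair_encoding {X : Type} [DecidableEq X] (Xout : Set X)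
    {n : ℕ} (ψ : LTLBody X n) (P Q : Prog X)
    (htP : Terminating P) (htQ : Terminating Q)
    (hfP : (SymPathsMax P).Finite) (hfQ : (SymPathsMax Q).Finite) :
    FullyTransparent Xout ψ P Q ↔
      (encAll ψ (SymPathsMax Q) ∧
        transEnc Xout ψ (SymPathsMax P) (SymPathsMax Q)) := by
  refine and_congr (satAll_iff_encAll ψ htQ) (forall_congr' fun σ => imp_congr ?_ ?_)
  · constructor
    · intro h
      obtain ⟨pP, hpP, hP⟩ := exists_mem_symPathsMax htP σ
      obtain ⟨pQ, hpQ, hQ⟩ := exists_mem_symPathsMax htQ σ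
      exact ⟨pP, hpP, pQ, hpQ, hP, hQ, outDiff_evalTrace_iff.mp <|
        (outDiff_congr (obsTrace_agree_evalTrace htP hpP hP)
          (obsTrace_agree_evalTrace htQ hpQ hQ)).mp h⟩
    · rintro ⟨pP, hpP, pQ, hpQ, hP, hQ, h⟩
      exact (outDiff_congr (obsTrace_agree_evalTrace htP hpP hP)
        (obsTrace_agree_evalTrace htQ hpQ hQ)).mpr (outDiff_evalTrace_iff.mpr h)
  · constructor
    · rintro ⟨σs, hσ, h⟩
      choose ps hps hσs using fun j => exists_mem_symPathsMax htP (σs j)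
      exact ⟨σs, ps, hps, hσs, hσ, fun hb => h <|
        (bodySat_congr (fun j => obsTrace_agree_evalTrace htP (hps j) (hσs j)) ψ 0).mpr hb⟩
    · rintro ⟨σs, ps, hps, hσs, hσ, h⟩
      exact ⟨σs, hσ, fun hb => h <|
        (bodySat_congr (fun j => obsTrace_agree_evalTrace htP (hps j) (hσs j)) ψ 0).mp hb⟩

end HyRep
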